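/- arXiv:1911.07795 — 3 statements merged into one kernel-verified Lean document; each statement's English description precedes it below -/
import Mathlib

section
/- Suppose $\tilde\psi$ satisfies both $\mathcal D\tilde\psi=\frac{\hbar^2}{x-x'}\big(\partial_x\tilde\psi+\partial_{x'}\tilde\psi\big)$ and $\mathcal D'\tilde\psi=-\frac{\hbar^2}{x-x'}\big(\partial_x\tilde\psi+\partial_{x'}\tilde\psi\big)$ at every point of $\Omega$. Then at every point of $\Omega$ the reduced equation holds: $\mathcal D(\mathcal D\tilde\psi)=\frac{\hbar^2}{x-x'}\Big(\partial_x R(x,t)-\frac{R(x,t)-R(x',t)}{x-x'}\Big)\,\tilde\psi$. In particular the left-hand side is a fourth-order operator in $x$ applied to $\tilde\psi$, and all dependence on $\partial_{x'}$ has been eliminated. -/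
/-- Partial derivative in the first variable. -/
noncomputable def pdx (f : ℝ → ℝ → ℝ → ℂ) : ℝ → ℝ → ℝ → ℂ :=
  fun x x' t => deriv (fun s => f s x' t) x

/-- Partial derivative in the second variable. -/
noncomputable def pdx' (f : ℝ → ℝ → ℝ → ℂ) : ℝ → ℝ → ℝ → ℂ :=
  fun x x' t => deriv (fun s => f x s t) x'

/-- Partial derivative in the third variable. -/
noncomputable def pdt (f : ℝ → ℝ → ℝ → ℂ) : ℝ → ℝ → ℝ → ℂ :=
  fun x x' t => deriv (fun s => f x x' s) t

/-- The operator `𝒟 = ℏ²∂ₓ² - ℏ²∂ₜ - R(x,t)` acting on functions of `(x,x',t)`. -/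
noncomputable def Dop (h : ℝ) (R : ℝ → ℝ → ℂ) (f : ℝ → ℝ → ℝ → ℂ) : ℝ → ℝ → ℝ → ℂ :=
  fun x x' t => (h : ℂ) ^ 2 * pdx (pdx f) x x' t - (h : ℂ) ^ 2 * pdt f x x' t
    - R x t * f x x' t

/-- The operator `𝒟' = ℏ²∂ₓ'² - ℏ²∂ₜ - R(x',t)` acting on functions of `(x,x',t)`. -/
noncomputable def Dop' (h : ℝ) (R : ℝ → ℝ → ℂ) (f : ℝ → ℝ → ℝ → ℂ) : ℝ → ℝ → ℝ → ℂ :=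
  fun x x' t => (h : ℂ) ^ 2 * pdx' (pdx' f) x x' t - (h : ℂ) ^ 2 * pdt f x x' t
    - R x' t * f x x' t

open scoped ContDiff

/-- Joint smoothness of a curried function of three real variables. -/
def SmoothThree (f : ℝ → ℝ → ℝ → ℂ) : Prop :=
  ContDiff ℝ ∞ (fun p : ℝ × ℝ × ℝ => f p.1 p.2.1 p.2.2)

/-- Directional derivative of a curried function of three real variables. -/
noncomputable def dirDeriv (v : ℝ × ℝ × ℝ) (f : ℝ → ℝ → ℝ → ℂ) : ℝ → ℝ → ℝ → ℂ :=
  fun x y t => fderiv ℝ (fun p : ℝ × ℝ × ℝ => f p.1 p.2.1 p.2.2) (x, y, t) v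

namespace SmoothThree

variable {f g : ℝ → ℝ → ℝ → ℂ}

protected theorem add (hf : SmoothThree f) (hg : SmoothThree g) :
    SmoothThree (fun x y t => f x y t + g x y t) :=
  ContDiff.add hf hg

protected theorem sub (hf : SmoothThree f) (hg : SmoothThree g) :
    SmoothThree (fun x y t => f x y t - g x y t) :=
  ContDiff.sub hf hg

protected theorem mul (hf : SmoothThree f) (hg : SmoothThree g) :
    SmoothThree (fun x y t => f x y t * g x y t) :=
  ContDiff.mul hf hg

protected theorem const (c : ℂ) : SmoothThree (fun _ _ _ => c) :=
  contDiff_const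

protected theorem hasFDerivAt (hf : SmoothThree f) (p : ℝ × ℝ × ℝ) :
    HasFDerivAt (fun p : ℝ × ℝ × ℝ => f p.1 p.2.1 p.2.2)
      (fderiv ℝ (fun p : ℝ × ℝ × ℝ => f p.1 p.2.1 p.2.2) p) p :=
  ((ContDiff.differentiable hf (by simp)) p).hasFDerivAt

theorem hasDerivAt_dirDeriv_fst (hf : SmoothThree f) (x y t : ℝ) :
    HasDerivAt (fun s => f s y t) (dirDeriv (1, 0, 0) f x y t) x :=
  HasFDerivAt.comp_hasDerivAt (f := fun s : ℝ => (s, y, t)) x (hf.hasFDerivAt (x, y, t))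
    ((hasDerivAt_id x).prodMk ((hasDerivAt_const x y).prodMk (hasDerivAt_const x t)))

theorem hasDerivAt_dirDeriv_snd (hf : SmoothThree f) (x y t : ℝ) :
    HasDerivAt (fun s => f x s t) (dirDeriv (0, 1, 0) f x y t) y :=
  HasFDerivAt.comp_hasDerivAt (f := fun s : ℝ => (x, s, t)) y (hf.hasFDerivAt (x, y, t))
    ((hasDerivAt_const y x).prodMk ((hasDerivAt_id y).prodMk (hasDerivAt_const y t)))

theorem hasDerivAt_dirDeriv_trd (hf : SmoothThree f) (x y t : ℝ) :
    HasDerivAt (fun s => f x y s) (dirDeriv (0, 0, 1) f x y t) t :=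
  HasFDerivAt.comp_hasDerivAt (f := fun s : ℝ => (x, y, s)) t (hf.hasFDerivAt (x, y, t))
    ((hasDerivAt_const t x).prodMk ((hasDerivAt_const t y).prodMk (hasDerivAt_id t)))

theorem pdx_eq (hf : SmoothThree f) : pdx f = dirDeriv (1, 0, 0) f := by
  funext x y t
  exact (hf.hasDerivAt_dirDeriv_fst x y t).deriv

theorem pdx'_eq (hf : SmoothThree f) : pdx' f = dirDeriv (0, 1, 0) f := by
  funext x y t
  exact (hf.hasDerivAt_dirDeriv_snd x y t).deriv

theorem pdt_eq (hf : SmoothThree f) : pdt f = dirDeriv (0, 0, 1) f := by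
  funext x y t
  exact (hf.hasDerivAt_dirDeriv_trd x y t).deriv

theorem hasDerivAt_pdx (hf : SmoothThree f) (x y t : ℝ) :
    HasDerivAt (fun s => f s y t) (pdx f x y t) x :=
  (hf.hasDerivAt_dirDeriv_fst x y t).differentiableAt.hasDerivAt

theorem hasDerivAt_pdx' (hf : SmoothThree f) (x y t : ℝ) :
    HasDerivAt (fun s => f x s t) (pdx' f x y t) y :=
  (hf.hasDerivAt_dirDeriv_snd x y t).differentiableAt.hasDerivAt

theorem hasDerivAt_pdt (hf : SmoothThree f) (x y t : ℝ) :
    HasDerivAt (fun s => f x y s) (pdt f x y t) t :=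
  (hf.hasDerivAt_dirDeriv_trd x y t).differentiableAt.hasDerivAt

protected theorem dirDeriv (hf : SmoothThree f) (v : ℝ × ℝ × ℝ) : SmoothThree (dirDeriv v f) :=
  (ContDiff.fderiv_right (m := ∞) hf (by simp)).clm_apply contDiff_const

protected theorem pdx (hf : SmoothThree f) : SmoothThree (pdx f) := by
  rw [hf.pdx_eq]
  exact hf.dirDeriv _

protected theorem pdx' (hf : SmoothThree f) : SmoothThree (pdx' f) := by
  rw [hf.pdx'_eq]
  exact hf.dirDeriv _

protected theorem pdt (hf : SmoothThree f) : SmoothThree (pdt f) := by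
  rw [hf.pdt_eq]
  exact hf.dirDeriv _

theorem dirDeriv_comm (hf : SmoothThree f) (v w : ℝ × ℝ × ℝ) :
    dirDeriv v (dirDeriv w f) = dirDeriv w (dirDeriv v f) := by
  funext x y t
  have hsymm : IsSymmSndFDerivAt ℝ (fun p : ℝ × ℝ × ℝ => f p.1 p.2.1 p.2.2) (x, y, t) :=
    (ContDiff.contDiffAt hf).isSymmSndFDerivAt (by
      rw [minSmoothness_of_isRCLikeNormedField]
      exact WithTop.coe_le_coe.2 (le_top : (2 : ℕ∞) ≤ ⊤))
  have hd : DifferentiableAt ℝ (fderiv ℝ (fun p : ℝ × ℝ × ℝ => f p.1 p.2.1 p.2.2)) (x, y, t) :=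
    ((ContDiff.fderiv_right (m := ∞) hf (by simp)).differentiable (by simp)) _
  have key (a b : ℝ × ℝ × ℝ) : dirDeriv a (dirDeriv b f) x y t
      = fderiv ℝ (fderiv ℝ (fun p : ℝ × ℝ × ℝ => f p.1 p.2.1 p.2.2)) (x, y, t) a b := by
    change fderiv ℝ (fun p => fderiv ℝ (fun p : ℝ × ℝ × ℝ => f p.1 p.2.1 p.2.2) p b) (x, y, t) a = _
    rw [fderiv_clm_apply hd (differentiableAt_const b)]
    simp
  rw [key, key]
  exact hsymm v w

theorem pdx_pdx'_comm (hf : SmoothThree f) :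
    pdx (pdx' f) = pdx' (pdx f) := by
  rw [hf.pdx'.pdx_eq, hf.pdx.pdx'_eq, hf.pdx'_eq, hf.pdx_eq, hf.dirDeriv_comm]

theorem pdx_pdt_comm (hf : SmoothThree f) :
    pdx (pdt f) = pdt (pdx f) := by
  rw [hf.pdt.pdx_eq, hf.pdx.pdt_eq, hf.pdt_eq, hf.pdx_eq, hf.dirDeriv_comm]

theorem pdx'_pdt_comm (hf : SmoothThree f) :
    pdx' (pdt f) = pdt (pdx' f) := by
  rw [hf.pdt.pdx'_eq, hf.pdx'.pdt_eq, hf.pdt_eq, hf.pdx'_eq, hf.dirDeriv_comm]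

protected theorem Dop {R : ℝ → ℝ → ℂ} (hf : SmoothThree f) (h : ℝ)
    (hR : SmoothThree (fun x _ t => R x t)) : SmoothThree (Dop h R f) :=
  (((SmoothThree.const _).mul hf.pdx.pdx).sub ((SmoothThree.const _).mul hf.pdt)).sub (hR.mul hf)

end SmoothThree

/-- the reduced equation, eliminating all `∂ₓ'` dependence. -/
theorem stmt2 (h : ℝ) (hh : h ≠ 0)
    (R : ℝ → ℝ → ℂ) (hR : ContDiff ℝ (⊤ : ℕ∞) (fun p : ℝ × ℝ => R p.1 p.2))
    (ψ : ℝ → ℝ → ℝ → ℂ) (hψ : ContDiff ℝ (⊤ : ℕ∞) (fun p : ℝ × ℝ × ℝ => ψ p.1 p.2.1 p.2.2))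
    (hpde : ∀ x x' t : ℝ, x ≠ x' →
      Dop h R ψ x x' t = (h : ℂ) ^ 2 / ((x : ℂ) - (x' : ℂ)) * (pdx ψ x x' t + pdx' ψ x x' t))
    (hpde' : ∀ x x' t : ℝ, x ≠ x' →
      Dop' h R ψ x x' t
        = -((h : ℂ) ^ 2 / ((x : ℂ) - (x' : ℂ)) * (pdx ψ x x' t + pdx' ψ x x' t))) :
    ∀ x x' t : ℝ, x ≠ x' →
      Dop h R (Dop h R ψ) x x' t
        = (h : ℂ) ^ 2 / ((x : ℂ) - (x' : ℂ))
          * (deriv (fun s => R s t) x - (R x t - R x' t) / ((x : ℂ) - (x' : ℂ)))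
          * ψ x x' t := by
  have sψ : SmoothThree ψ := hψ
  have sR : SmoothThree (fun x _ t => R x t) :=
    hR.comp (contDiff_fst.prodMk (contDiff_snd.comp contDiff_snd))
  have sG := sψ.Dop h sR
  have hG : Dop h R ψ = fun x y t => (h : ℂ) ^ 2 * pdx (pdx ψ) x y t
    - (h : ℂ) ^ 2 * pdt ψ x y t - R x t * ψ x y t := rfl
  set G := Dop h R ψ
  have hRx (x t : ℝ) : HasDerivAt (fun s => R s t) (deriv (fun s => R s t) x) x :=
    (sR.hasDerivAt_dirDeriv_fst x 0 t).differentiableAt.hasDerivAt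
  have hfst (x y : ℝ) : HasDerivAt (fun s : ℝ => (s : ℂ) - (y : ℂ)) 1 x :=
    (Complex.ofRealCLM.hasDerivAt (x := x)).sub_const _
  have hsnd (x y : ℝ) : HasDerivAt (fun s : ℝ => (x : ℂ) - (s : ℂ)) (-1) y :=
    (Complex.ofRealCLM.hasDerivAt (x := y)).const_sub _
  have hmul : ∀ x y t : ℝ,
      ((x : ℂ) - y) * G x y t = (h : ℂ) ^ 2 * (pdx ψ x y t + pdx' ψ x y t) := by
    intro x y t
    refine congrFun (Continuous.ext_on (dense_compl_singleton y)
      (f := fun x : ℝ => ((x : ℂ) - y) * G x y t)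
      (g := fun x : ℝ => (h : ℂ) ^ 2 * (pdx ψ x y t + pdx' ψ x y t)) ?_ ?_ ?_) x
    · exact continuous_iff_continuousAt.2 fun s =>
        ((hfst s y).mul (sG.hasDerivAt_pdx s y t)).continuousAt
    · exact continuous_iff_continuousAt.2 fun s =>
        (((sψ.pdx.add sψ.pdx').hasDerivAt_pdx s y t).const_mul _).continuousAt
    · intro s hs
      have hne : (s : ℂ) - y ≠ 0 := sub_ne_zero.2 (by exact_mod_cast hs)
      change ((s : ℂ) - y) * G s y t = _
      rw [hpde s y t hs]
      field_simp
  have hmul_x : ∀ x y t : ℝ, G x y t + ((x : ℂ) - y) * pdx G x y t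
      = (h : ℂ) ^ 2 * (pdx (pdx ψ) x y t + pdx (pdx' ψ) x y t) := by
    intro x y t
    have hl := (hfst x y).mul (sG.hasDerivAt_pdx x y t)
    have hr := ((sψ.pdx.hasDerivAt_pdx x y t).add (sψ.pdx'.hasDerivAt_pdx x y t)).const_mul
      ((h : ℂ) ^ 2)
    simpa using hl.unique (hr.congr_of_eventuallyEq (.of_forall fun s => hmul s y t))
  have hmul_xx : ∀ x y t : ℝ, 2 * pdx G x y t + ((x : ℂ) - y) * pdx (pdx G) x y t
      = (h : ℂ) ^ 2 * (pdx (pdx (pdx ψ)) x y t + pdx (pdx (pdx' ψ)) x y t) := by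
    intro x y t
    have hl := (sG.hasDerivAt_pdx x y t).add ((hfst x y).mul (sG.pdx.hasDerivAt_pdx x y t))
    have hr := ((sψ.pdx.pdx.hasDerivAt_pdx x y t).add
      (sψ.pdx'.pdx.hasDerivAt_pdx x y t)).const_mul ((h : ℂ) ^ 2)
    have := hl.unique (hr.congr_of_eventuallyEq (.of_forall fun s => hmul_x s y t))
    linear_combination this
  have hmul_y : ∀ x y t : ℝ, -G x y t + ((x : ℂ) - y) * pdx' G x y t
      = (h : ℂ) ^ 2 * (pdx' (pdx ψ) x y t + pdx' (pdx' ψ) x y t) := by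
    intro x y t
    have hl := (hsnd x y).mul (sG.hasDerivAt_pdx' x y t)
    have hr := ((sψ.pdx.hasDerivAt_pdx' x y t).add (sψ.pdx'.hasDerivAt_pdx' x y t)).const_mul
      ((h : ℂ) ^ 2)
    simpa using hl.unique (hr.congr_of_eventuallyEq (.of_forall fun s => hmul x s t))
  have hmul_t : ∀ x y t : ℝ, ((x : ℂ) - y) * pdt G x y t
      = (h : ℂ) ^ 2 * (pdt (pdx ψ) x y t + pdt (pdx' ψ) x y t) := by
    intro x y t
    have hl := (sG.hasDerivAt_pdt x y t).const_mul ((x : ℂ) - y)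
    have hr := ((sψ.pdx.hasDerivAt_pdt x y t).add (sψ.pdx'.hasDerivAt_pdt x y t)).const_mul
      ((h : ℂ) ^ 2)
    exact hl.unique (hr.congr_of_eventuallyEq (.of_forall fun s => hmul x y s))
  have hG_x : ∀ x y t : ℝ, pdx G x y t = (h : ℂ) ^ 2 * pdx (pdx (pdx ψ)) x y t
      - (h : ℂ) ^ 2 * pdx (pdt ψ) x y t
      - (deriv (fun s => R s t) x * ψ x y t + R x t * pdx ψ x y t) := by
    intro x y t
    rw [hG]
    exact ((((sψ.pdx.pdx.hasDerivAt_pdx x y t).const_mul _).sub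
      ((sψ.pdt.hasDerivAt_pdx x y t).const_mul _)).sub
      ((hRx x t).mul (sψ.hasDerivAt_pdx x y t))).deriv
  have hG_y : ∀ x y t : ℝ, pdx' G x y t = (h : ℂ) ^ 2 * pdx' (pdx (pdx ψ)) x y t
      - (h : ℂ) ^ 2 * pdx' (pdt ψ) x y t - R x t * pdx' ψ x y t := by
    intro x y t
    rw [hG]
    exact ((((sψ.pdx.pdx.hasDerivAt_pdx' x y t).const_mul _).sub
      ((sψ.pdt.hasDerivAt_pdx' x y t).const_mul _)).sub
      ((sψ.hasDerivAt_pdx' x y t).const_mul _)).deriv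
  intro x y t hxy
  have hne : (x : ℂ) - y ≠ 0 := sub_ne_zero.2 (by exact_mod_cast hxy)
  have e := hmul x y t
  have ex := hmul_x x y t
  have exx := hmul_xx x y t
  have ey := hmul_y x y t
  have et := hmul_t x y t
  have gx := hG_x x y t
  have gy := hG_y x y t
  have hsub : G x y t + ((h : ℂ) ^ 2 * pdx' (pdx' ψ) x y t - (h : ℂ) ^ 2 * pdt ψ x y t
      - R y t * ψ x y t) = 0 := by
    have h' := hpde' x y t hxy
    rw [← hpde x y t hxy] at h'
    change G x y t + Dop' h R ψ x y t = 0
    rw [h']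
    ring
  have hGdef : G x y t = (h : ℂ) ^ 2 * pdx (pdx ψ) x y t
    - (h : ℂ) ^ 2 * pdt ψ x y t - R x t * ψ x y t := rfl
  rw [sψ.pdx_pdx'_comm] at ex exx
  rw [sψ.pdx.pdx_pdx'_comm] at exx
  rw [sψ.pdx_pdt_comm] at gx
  rw [sψ.pdx'_pdt_comm] at gy
  have hfirst : ((x : ℂ) - y) * Dop h R G x y t
      = (h : ℂ) ^ 2 * (deriv (fun s => R s t) x * ψ x y t + pdx' G x y t - pdx G x y t) := by
    unfold Dop
    linear_combination (h : ℂ) ^ 2 * exx - (h : ℂ) ^ 2 * et - R x t * e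
      - (h : ℂ) ^ 2 * gx - (h : ℂ) ^ 2 * gy
  have hsecond : ((x : ℂ) - y) * (pdx' G x y t - pdx G x y t)
      = -((R x t - R y t) * ψ x y t) := by
    linear_combination ey - ex + hsub + hGdef
  generalize Dop h R G x y t = A at *
  have hA : ((x : ℂ) - y) ^ 2 * A = (h : ℂ) ^ 2
      * (((x : ℂ) - y) * deriv (fun s => R s t) x - (R x t - R y t)) * ψ x y t := by
    linear_combination ((x : ℂ) - y) * hfirst + (h : ℂ) ^ 2 * hsecond
  field_simp
  linear_combination hA
end

section
/- Let $V\colon\mathbb{R}\to\mathbb{C}$ be $C^\infty$ and take $R(x,t):=x^3+t\,x+V(t)$ (the family of elliptic spectral curves $y^2=x^3+tx+V$). Suppose $\tilde\psi$ satisfies both $\mathcal D\tilde\psi=\frac{\hbar^2}{x-x'}\big(\partial_x\tilde\psi+\partial_{x'}\tilde\psi\big)$ and $\mathcal D'\tilde\psi=-\frac{\hbar^2}{x-x'}\big(\partial_x\tilde\psi+\partial_{x'}\tilde\psi\big)$ at every point of $\Omega$. Then at every point of $\Omega$: $\mathcal D(\mathcal D\tilde\psi)=\hbar^2\,(2x+x')\,\tilde\psi$.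 -/
/-- A curried function of `(x,x',t)` is smooth when its uncurried form is. -/
def IsSmooth (f : ℝ → ℝ → ℝ → ℂ) : Prop :=
  ContDiff ℝ (⊤ : ℕ∞) (fun p : ℝ × ℝ × ℝ => f p.1 p.2.1 p.2.2)

namespace IsSmooth

variable {f g : ℝ → ℝ → ℝ → ℂ}

theorem add (hf : IsSmooth f) (hg : IsSmooth g) : IsSmooth (f + g) := ContDiff.add hf hg

theorem sub (hf : IsSmooth f) (hg : IsSmooth g) : IsSmooth (f - g) := ContDiff.sub hf hg

theorem mul (hf : IsSmooth f) (hg : IsSmooth g) : IsSmooth (f * g) := ContDiff.mul hf hg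

theorem const (c : ℂ) : IsSmooth (fun _ _ _ => c) := contDiff_const

theorem differentiable (hf : IsSmooth f) :
    Differentiable ℝ (fun p : ℝ × ℝ × ℝ => f p.1 p.2.1 p.2.2) :=
  ContDiff.differentiable hf (by simp)

theorem differentiableAt_fst (hf : IsSmooth f) (x x' t : ℝ) :
    DifferentiableAt ℝ (fun s => f s x' t) x :=
  (hf.differentiable (x, x', t)).comp x
    (f := fun s : ℝ => (s, x', t)) (by fun_prop)

theorem differentiableAt_snd (hf : IsSmooth f) (x x' t : ℝ) :
    DifferentiableAt ℝ (fun s => f x s t) x' :=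
  (hf.differentiable (x, x', t)).comp x'
    (f := fun s : ℝ => (x, s, t)) (by fun_prop)

theorem differentiableAt_thd (hf : IsSmooth f) (x x' t : ℝ) :
    DifferentiableAt ℝ (fun s => f x x' s) t :=
  (hf.differentiable (x, x', t)).comp t
    (f := fun s : ℝ => (x, x', s)) (by fun_prop)

theorem pdx_eq_fderiv (hf : IsSmooth f) (x x' t : ℝ) :
    pdx f x x' t = fderiv ℝ (fun p : ℝ × ℝ × ℝ => f p.1 p.2.1 p.2.2) (x, x', t) (1, 0, 0) :=
  ((hf.differentiable (x, x', t)).hasFDerivAt.comp_hasDerivAt x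
    (f := fun s : ℝ => (s, x', t))
    ((hasDerivAt_id x).prodMk ((hasDerivAt_const x x').prodMk (hasDerivAt_const x t)))).deriv

theorem pdx'_eq_fderiv (hf : IsSmooth f) (x x' t : ℝ) :
    pdx' f x x' t = fderiv ℝ (fun p : ℝ × ℝ × ℝ => f p.1 p.2.1 p.2.2) (x, x', t) (0, 1, 0) :=
  ((hf.differentiable (x, x', t)).hasFDerivAt.comp_hasDerivAt x'
    (f := fun s : ℝ => (x, s, t))
    ((hasDerivAt_const x' x).prodMk ((hasDerivAt_id x').prodMk (hasDerivAt_const x' t)))).deriv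

theorem pdt_eq_fderiv (hf : IsSmooth f) (x x' t : ℝ) :
    pdt f x x' t = fderiv ℝ (fun p : ℝ × ℝ × ℝ => f p.1 p.2.1 p.2.2) (x, x', t) (0, 0, 1) :=
  ((hf.differentiable (x, x', t)).hasFDerivAt.comp_hasDerivAt t
    (f := fun s : ℝ => (x, x', s))
    ((hasDerivAt_const t x).prodMk ((hasDerivAt_const t x').prodMk (hasDerivAt_id t)))).deriv

theorem fderiv_apply (hf : IsSmooth f) (v : ℝ × ℝ × ℝ) :
    ContDiff ℝ (⊤ : ℕ∞)
      (fun p => fderiv ℝ (fun p : ℝ × ℝ × ℝ => f p.1 p.2.1 p.2.2) p v) :=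
  (ContDiff.fderiv_right hf (by simp)).clm_apply contDiff_const

theorem pdx (hf : IsSmooth f) : IsSmooth (pdx f) := by
  simpa only [IsSmooth, hf.pdx_eq_fderiv] using hf.fderiv_apply (1, 0, 0)

theorem pdx' (hf : IsSmooth f) : IsSmooth (pdx' f) := by
  simpa only [IsSmooth, hf.pdx'_eq_fderiv] using hf.fderiv_apply (0, 1, 0)

theorem pdt (hf : IsSmooth f) : IsSmooth (pdt f) := by
  simpa only [IsSmooth, hf.pdt_eq_fderiv] using hf.fderiv_apply (0, 0, 1)

theorem fderiv_fderiv_comm (hf : IsSmooth f) (p v w : ℝ × ℝ × ℝ) :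
    fderiv ℝ (fun q => fderiv ℝ (fun p : ℝ × ℝ × ℝ => f p.1 p.2.1 p.2.2) q v) p w
      = fderiv ℝ (fun q => fderiv ℝ (fun p : ℝ × ℝ × ℝ => f p.1 p.2.1 p.2.2) q w) p v := by
  have hd : DifferentiableAt ℝ (fderiv ℝ (fun p : ℝ × ℝ × ℝ => f p.1 p.2.1 p.2.2)) p :=
    (ContDiff.fderiv_right hf (m := 1) (by norm_cast)).differentiable (by simp) p
  have hs : IsSymmSndFDerivAt ℝ (fun p : ℝ × ℝ × ℝ => f p.1 p.2.1 p.2.2) p :=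
    (ContDiff.contDiffAt hf).isSymmSndFDerivAt (by simpa using WithTop.coe_le_coe.mpr (le_top : (2 : ℕ∞) ≤ ⊤))
  rw [fderiv_clm_apply hd (by fun_prop), fderiv_clm_apply hd (by fun_prop)]
  simpa using hs.eq w v

theorem pdx_pdx'_comm (hf : IsSmooth f) : _root_.pdx (_root_.pdx' f) = _root_.pdx' (_root_.pdx f) := by
  funext x x' t
  rw [hf.pdx'.pdx_eq_fderiv, hf.pdx.pdx'_eq_fderiv]
  simp only [hf.pdx_eq_fderiv, hf.pdx'_eq_fderiv]
  exact hf.fderiv_fderiv_comm _ _ _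

theorem pdx_pdt_comm (hf : IsSmooth f) : _root_.pdx (_root_.pdt f) = _root_.pdt (_root_.pdx f) := by
  funext x x' t
  rw [hf.pdt.pdx_eq_fderiv, hf.pdx.pdt_eq_fderiv]
  simp only [hf.pdx_eq_fderiv, hf.pdt_eq_fderiv]
  exact hf.fderiv_fderiv_comm _ _ _

theorem pdx'_pdt_comm (hf : IsSmooth f) :
    _root_.pdx' (_root_.pdt f) = _root_.pdt (_root_.pdx' f) := by
  funext x x' t
  rw [hf.pdt.pdx'_eq_fderiv, hf.pdx'.pdt_eq_fderiv]
  simp only [hf.pdx'_eq_fderiv, hf.pdt_eq_fderiv]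
  exact hf.fderiv_fderiv_comm _ _ _

end IsSmooth

section Rules

variable {f g : ℝ → ℝ → ℝ → ℂ}

theorem pdx_add (hf : IsSmooth f) (hg : IsSmooth g) :
    pdx (f + g) = pdx f + pdx g := by
  funext x x' t
  exact deriv_fun_add (hf.differentiableAt_fst x x' t) (hg.differentiableAt_fst x x' t)

theorem pdx_sub (hf : IsSmooth f) (hg : IsSmooth g) :
    pdx (f - g) = pdx f - pdx g := by
  funext x x' t
  exact deriv_fun_sub (hf.differentiableAt_fst x x' t) (hg.differentiableAt_fst x x' t)

theorem pdx_mul (hf : IsSmooth f) (hg : IsSmooth g) :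
    pdx (f * g) = pdx f * g + f * pdx g := by
  funext x x' t
  exact deriv_fun_mul (hf.differentiableAt_fst x x' t) (hg.differentiableAt_fst x x' t)

theorem pdx_const (c : ℂ) : pdx (fun _ _ _ => c) = 0 := by
  funext x x' t
  exact deriv_const _ c

theorem pdx'_add (hf : IsSmooth f) (hg : IsSmooth g) :
    pdx' (f + g) = pdx' f + pdx' g := by
  funext x x' t
  exact deriv_fun_add (hf.differentiableAt_snd x x' t) (hg.differentiableAt_snd x x' t)

theorem pdx'_sub (hf : IsSmooth f) (hg : IsSmooth g) :
    pdx' (f - g) = pdx' f - pdx' g := by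
  funext x x' t
  exact deriv_fun_sub (hf.differentiableAt_snd x x' t) (hg.differentiableAt_snd x x' t)

theorem pdx'_mul (hf : IsSmooth f) (hg : IsSmooth g) :
    pdx' (f * g) = pdx' f * g + f * pdx' g := by
  funext x x' t
  exact deriv_fun_mul (hf.differentiableAt_snd x x' t) (hg.differentiableAt_snd x x' t)

theorem pdx'_const (c : ℂ) : pdx' (fun _ _ _ => c) = 0 := by
  funext x x' t
  exact deriv_const _ c

theorem pdt_add (hf : IsSmooth f) (hg : IsSmooth g) :
    pdt (f + g) = pdt f + pdt g := by
  funext x x' t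
  exact deriv_fun_add (hf.differentiableAt_thd x x' t) (hg.differentiableAt_thd x x' t)

theorem pdt_mul (hf : IsSmooth f) (hg : IsSmooth g) :
    pdt (f * g) = pdt f * g + f * pdt g := by
  funext x x' t
  exact deriv_fun_mul (hf.differentiableAt_thd x x' t) (hg.differentiableAt_thd x x' t)

theorem pdt_const (c : ℂ) : pdt (fun _ _ _ => c) = 0 := by
  funext x x' t
  exact deriv_const _ c

theorem pdx_congr_offDiag (h : ∀ x x' t : ℝ, x ≠ x' → f x x' t = g x x' t)
    (x x' t : ℝ) (hne : x ≠ x') : pdx f x x' t = pdx g x x' t :=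
  Filter.EventuallyEq.deriv_eq ((eventually_ne_nhds hne).mono fun s hs => h s x' t hs)

theorem pdx'_congr_offDiag (h : ∀ x x' t : ℝ, x ≠ x' → f x x' t = g x x' t)
    (x x' t : ℝ) (hne : x ≠ x') : pdx' f x x' t = pdx' g x x' t :=
  Filter.EventuallyEq.deriv_eq ((eventually_ne_nhds hne.symm).mono fun s hs => h x s t hs.symm)

theorem pdt_congr_offDiag (h : ∀ x x' t : ℝ, x ≠ x' → f x x' t = g x x' t)
    (x x' t : ℝ) (hne : x ≠ x') : pdt f x x' t = pdt g x x' t :=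
  Filter.EventuallyEq.deriv_eq (Filter.Eventually.of_forall fun s => h x x' s hne)

end Rules

theorem Dop_eq (h : ℝ) (R : ℝ → ℝ → ℂ) (f : ℝ → ℝ → ℝ → ℂ) :
    Dop h R f = (fun _ _ _ => (h : ℂ) ^ 2) * pdx (pdx f) - (fun _ _ _ => (h : ℂ) ^ 2) * pdt f
      - (fun x _ t => R x t) * f := rfl

theorem IsSmooth.Dop {h : ℝ} {R : ℝ → ℝ → ℂ} {f : ℝ → ℝ → ℝ → ℂ}
    (hR : IsSmooth fun x _ t => R x t) (hf : IsSmooth f) : IsSmooth (Dop h R f) :=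
  (((IsSmooth.const _).mul hf.pdx.pdx).sub ((IsSmooth.const _).mul hf.pdt)).sub (hR.mul hf)

/-- The commutator of `𝒟` with `∂ₓ + ∂ₓ'` is multiplication by `∂ₓR`. -/
theorem Dop_pdx_add_pdx' {h : ℝ} {R : ℝ → ℝ → ℂ} {f : ℝ → ℝ → ℝ → ℂ}
    (hR : IsSmooth fun x _ t => R x t) (hf : IsSmooth f) :
    Dop h R (pdx f + pdx' f) = pdx (Dop h R f) + pdx' (Dop h R f)
      + pdx (fun x _ t => R x t) * f := by
  have hc := IsSmooth.const ((h : ℂ) ^ 2)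
  have hxx := hc.mul hf.pdx.pdx
  have ht := hc.mul hf.pdt
  have hR' : pdx' (fun x _ t => R x t) = 0 := by
    funext x x' t
    exact deriv_const _ _
  rw [Dop_eq, Dop_eq, pdx_add hf.pdx hf.pdx', pdx_add hf.pdx.pdx hf.pdx'.pdx,
    pdt_add hf.pdx hf.pdx', pdx_sub (hxx.sub ht) (hR.mul hf), pdx_sub hxx ht,
    pdx'_sub (hxx.sub ht) (hR.mul hf), pdx'_sub hxx ht, pdx_mul hc hf.pdx.pdx,
    pdx_mul hc hf.pdt, pdx_mul hR hf, pdx'_mul hc hf.pdx.pdx, pdx'_mul hc hf.pdt,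
    pdx'_mul hR hf, pdx_const, pdx'_const, hR', hf.pdx_pdt_comm, hf.pdx'_pdt_comm,
    hf.pdx_pdx'_comm, hf.pdx.pdx_pdx'_comm]
  ring

/-- The coordinate difference `x - x'`. -/
def coordDiff : ℝ → ℝ → ℝ → ℂ := fun x x' _ => (x : ℂ) - (x' : ℂ)

theorem isSmooth_coordDiff : IsSmooth coordDiff :=
  (Complex.ofRealCLM.contDiff.comp contDiff_fst).sub
    (Complex.ofRealCLM.contDiff.comp (contDiff_fst.comp contDiff_snd))

theorem pdx_coordDiff : pdx coordDiff = fun _ _ _ => 1 := by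
  funext x x' t
  exact ((Complex.ofRealCLM.hasDerivAt (x := x)).sub_const (x' : ℂ)).deriv.trans (by simp)

theorem pdx'_coordDiff : pdx' coordDiff = fun _ _ _ => -1 := by
  funext x x' t
  exact ((Complex.ofRealCLM.hasDerivAt (x := x')).const_sub (x : ℂ)).deriv.trans (by simp)

theorem pdt_coordDiff : pdt coordDiff = 0 := by
  funext x x' t
  exact deriv_const _ _

theorem isSmooth_ellipticPotential {V : ℝ → ℂ} (hV : ContDiff ℝ (⊤ : ℕ∞) V) :
    IsSmooth (fun x _ t => (x : ℂ) ^ 3 + (t : ℂ) * (x : ℂ) + V t) := by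
  have hx : IsSmooth (fun x _ _ => (x : ℂ)) := Complex.ofRealCLM.contDiff.comp contDiff_fst
  have ht : IsSmooth (fun _ _ t => (t : ℂ)) :=
    Complex.ofRealCLM.contDiff.comp (contDiff_snd.comp contDiff_snd)
  have hVt : IsSmooth (fun _ _ t => V t) := hV.comp (contDiff_snd.comp contDiff_snd)
  exact (ContDiff.add (ContDiff.pow hx 3) (ht.mul hx)).add hVt

theorem pdx_ellipticPotential (V : ℝ → ℂ) :
    pdx (fun x _ t => (x : ℂ) ^ 3 + (t : ℂ) * (x : ℂ) + V t)
      = fun (x : ℝ) _ (t : ℝ) => 3 * (x : ℂ) ^ 2 + (t : ℂ) := by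
  funext x x' t
  have hx : HasDerivAt (fun s : ℝ => (s : ℂ)) 1 x := Complex.ofRealCLM.hasDerivAt
  exact (((hx.pow 3).add (hx.const_mul (t : ℂ))).add_const (V t)).deriv.trans (by simp)

/-- the reduced equation for the family of elliptic spectral curves
`y² = x³ + t x + V(t)`. -/
theorem stmt3 (h : ℝ) (hh : h ≠ 0)
    (V : ℝ → ℂ) (hV : ContDiff ℝ (⊤ : ℕ∞) V)
    (R : ℝ → ℝ → ℂ) (hRdef : R = fun (x t : ℝ) => (x : ℂ) ^ 3 + (t : ℂ) * (x : ℂ) + V t)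
    (ψ : ℝ → ℝ → ℝ → ℂ) (hψ : ContDiff ℝ (⊤ : ℕ∞) (fun p : ℝ × ℝ × ℝ => ψ p.1 p.2.1 p.2.2))
    (hpde : ∀ x x' t : ℝ, x ≠ x' →
      Dop h R ψ x x' t = (h : ℂ) ^ 2 / ((x : ℂ) - (x' : ℂ)) * (pdx ψ x x' t + pdx' ψ x x' t))
    (hpde' : ∀ x x' t : ℝ, x ≠ x' →
      Dop' h R ψ x x' t
        = -((h : ℂ) ^ 2 / ((x : ℂ) - (x' : ℂ)) * (pdx ψ x x' t + pdx' ψ x x' t))) :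
    ∀ x x' t : ℝ, x ≠ x' →
      Dop h R (Dop h R ψ) x x' t
        = (h : ℂ) ^ 2 * (2 * (x : ℂ) + (x' : ℂ)) * ψ x x' t := by
  intro x x' t hne
  have hR : IsSmooth fun x _ t => R x t := by
    rw [hRdef]
    exact isSmooth_ellipticPotential hV
  have hRx : pdx (fun x _ t => R x t) x x' t = 3 * (x : ℂ) ^ 2 + (t : ℂ) := by
    rw [hRdef, pdx_ellipticPotential]
  have hf : IsSmooth ψ := hψ
  have hc := IsSmooth.const ((h : ℂ) ^ 2)
  have hd := isSmooth_coordDiff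
  have hD0 : (x : ℂ) - x' ≠ 0 := sub_ne_zero.mpr (by exact_mod_cast hne)
  have hcomm := congrFun (congrFun (congrFun (Dop_pdx_add_pdx' (h := h) hR hf) x) x') t
  have hg : IsSmooth (Dop h R ψ) := hR.Dop hf
  have hw : IsSmooth (pdx ψ + pdx' ψ) := hf.pdx.add hf.pdx'
  have hwx : pdx (pdx ψ + pdx' ψ) x x' t + -pdx' (pdx ψ + pdx' ψ) x x' t
      = pdx (pdx ψ) x x' t - pdx' (pdx' ψ) x x' t := by
    rw [pdx_add hf.pdx hf.pdx', pdx'_add hf.pdx hf.pdx', hf.pdx_pdx'_comm]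
    simp only [Pi.add_apply]
    ring
  have hpsi := hpde x x' t hne
  have hpsi' := hpde' x x' t hne
  have hmul : ∀ x x' t : ℝ, x ≠ x' → (coordDiff * Dop h R ψ) x x' t
      = ((fun _ _ _ => (h : ℂ) ^ 2 : ℝ → ℝ → ℝ → ℂ) * (pdx ψ + pdx' ψ)) x x' t := by
    intro x x' t hne
    have hD0 : (x : ℂ) - x' ≠ 0 := sub_ne_zero.mpr (by exact_mod_cast hne)
    simp only [Pi.mul_apply, Pi.add_apply, coordDiff, hpde x x' t hne]
    field_simp
  generalize hG : Dop h R ψ = g at *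
  have hgpt : g x x' t = (h : ℂ) ^ 2 * pdx (pdx ψ) x x' t - (h : ℂ) ^ 2 * pdt ψ x x' t
      - R x t * ψ x x' t := by rw [← hG]; rfl
  have hwdef : (pdx ψ + pdx' ψ) x x' t = pdx ψ x x' t + pdx' ψ x x' t := rfl
  rw [← hwdef] at hpsi hpsi'
  generalize pdx ψ + pdx' ψ = w at *
  have hx := pdx_congr_offDiag hmul
  have hxx := pdx_congr_offDiag hx x x' t hne
  have hx' := pdx'_congr_offDiag hmul x x' t hne
  have ht := pdt_congr_offDiag hmul x x' t hne
  replace hx := hx x x' t hne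
  have hone := IsSmooth.const 1
  rw [pdx_mul hd hg, pdx_mul hc hw, pdx_coordDiff, pdx_const, zero_mul, zero_add] at hx hxx
  rw [pdx_add (hone.mul hg) (hd.mul hg.pdx), pdx_mul hone hg, pdx_mul hd hg.pdx,
    pdx_mul hc hw.pdx, pdx_coordDiff, pdx_const, pdx_const] at hxx
  rw [pdx'_mul hd hg, pdx'_mul hc hw, pdx'_coordDiff, pdx'_const] at hx'
  rw [pdt_mul hd hg, pdt_mul hc hw, pdt_coordDiff, pdt_const] at ht
  have hRR : R x t - R x' t = ((x : ℂ) - x') * ((x : ℂ) ^ 2 + x * x' + (x' : ℂ) ^ 2 + t) := by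
    rw [hRdef]
    ring
  have hmulpt := hmul x x' t hne
  have hquot : (h : ℂ) ^ 2 / ((x : ℂ) - x') * w x x' t = g x x' t := hpsi.symm
  rw [hquot] at hpsi'
  simp only [Pi.mul_apply, Pi.add_apply, Pi.zero_apply, coordDiff, hRx, Dop, Dop']
    at hx hxx hx' ht hmulpt hcomm hpsi' ⊢
  apply mul_left_cancel₀ (pow_ne_zero 2 hD0)
  linear_combination (h : ℂ) ^ 2 * (x - x') * hxx - (h : ℂ) ^ 2 * (x - x') * ht
    - (x - x') * R x t * hmulpt + (h : ℂ) ^ 2 * (x - x') * hcomm - (h : ℂ) ^ 2 * hx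
    + (h : ℂ) ^ 2 * hx' - (h : ℂ) ^ 4 * hwx + (h : ℂ) ^ 2 * hgpt + (h : ℂ) ^ 2 * hpsi'
    - (h : ℂ) ^ 2 * ψ x x' t * hRR
end

section
/- Given $U\in A$, define over $A[x]$ the Painlev\'e I Lax matrices $\mathcal L=\begin{pmatrix}\frac{\hbar}{2}dU & x-U\\ (x-U)(x+2U)+\frac{\hbar^2}{2}d^2U & -\frac{\hbar}{2}dU\end{pmatrix}$ and $\mathcal R=\begin{pmatrix}0 & 1\\ x+2U & 0\end{pmatrix}$. If there exists $t\in A$ with $dt=1$ such that $U$ satisfies the Painlev\'e I equation $\frac{\hbar^2}{2}d^2U-3U^2=t$, then the zero-curvature equation $\hbar\,d\mathcal L-\hbar\,\partial_x\mathcal R+[\mathcal L,\mathcal R]=0$ holds in $M_2(A[x])$. -/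
open Polynomial

/-- Coefficientwise extension of a map `d : A → A` to the polynomial ring `A[x]`
(so `dx = 0`). -/
noncomputable def dcoef {A : Type*} [CommRing A] (d : A → A) (p : Polynomial A) :
    Polynomial A :=
  p.sum fun n a => Polynomial.C (d a) * Polynomial.X ^ n

/-- The Painlevé I Lax matrix `ℒ`. -/
noncomputable def LmatP1 {A : Type*} [CommRing A] [Algebra ℚ A] (d : A → A) (hbar U : A) :
    Matrix (Fin 2) (Fin 2) (Polynomial A) :=
  !![(1/2 : ℚ) • (C (hbar * d U)), X - C U;
     (X - C U) * (X + 2 * C U) + (1/2 : ℚ) • (C (hbar ^ 2 * d (d U))),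
     -((1/2 : ℚ) • (C (hbar * d U)))]

/-- The Painlevé I Lax matrix `ℛ`. -/
noncomputable def RmatP1 {A : Type*} [CommRing A] (U : A) :
    Matrix (Fin 2) (Fin 2) (Polynomial A) :=
  !![0, 1; X + 2 * C U, 0]


theorem coeff_dcoef {A : Type*} [CommRing A] {d : A → A} (hd : d 0 = 0) (p : A[X]) (n : ℕ) :
    (dcoef d p).coeff n = d (p.coeff n) := by
  simp only [dcoef, Polynomial.sum, finsetSum_coeff, coeff_C_mul_X_pow]
  rw [Finset.sum_ite_eq]
  split_ifs with h
  · rfl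
  · rw [notMem_support_iff.mp h, hd]

section Derivation

variable {A : Type*} [CommRing A] [Algebra ℚ A] (d : Derivation ℚ A A)

theorem dcoef_add (p q : A[X]) :
    dcoef (fun a => d a) (p + q) = dcoef (fun a => d a) p + dcoef (fun a => d a) q := by
  ext n
  simp [coeff_dcoef]

theorem dcoef_neg (p : A[X]) : dcoef (fun a => d a) (-p) = -dcoef (fun a => d a) p := by
  ext n
  simp [coeff_dcoef]

theorem dcoef_sub (p q : A[X]) :
    dcoef (fun a => d a) (p - q) = dcoef (fun a => d a) p - dcoef (fun a => d a) q := by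
  simp only [sub_eq_add_neg, dcoef_add, dcoef_neg]

theorem dcoef_smul (r : ℚ) (p : A[X]) :
    dcoef (fun a => d a) (r • p) = r • dcoef (fun a => d a) p := by
  ext n
  simp [coeff_dcoef]

theorem dcoef_C (a : A) : dcoef (fun a => d a) (C a) = C (d a) := by
  ext n
  simp only [coeff_dcoef, map_zero, coeff_C]
  split_ifs <;> simp

theorem dcoef_X : dcoef (fun a => d a) (X : A[X]) = 0 := by
  ext n
  simp only [coeff_dcoef, map_zero, coeff_X, coeff_zero]
  split_ifs <;> simp

theorem dcoef_mul (p q : A[X]) :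
    dcoef (fun a => d a) (p * q) =
      p * dcoef (fun a => d a) q + q * dcoef (fun a => d a) p := by
  ext n
  rw [mul_comm q]
  simp only [coeff_dcoef, map_zero, coeff_mul, coeff_add, map_sum, Derivation.leibniz,
    smul_eq_mul, Finset.sum_add_distrib]
  simp only [mul_comm]

end Derivation

/-- if `U` satisfies the Painlevé I equation `ℏ²/2 d²U - 3U² = t`
for some `t` with `dt = 1`, then the zero-curvature equation
`ℏ dℒ - ℏ ∂ₓℛ + [ℒ,ℛ] = 0` holds. -/
theorem stmt6 {A : Type*} [CommRing A] [Algebra ℚ A] (d : Derivation ℚ A A)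
    (hbar : A) (hd : d hbar = 0) (U : A)
    (hP1 : ∃ t : A, d t = 1 ∧ (1/2 : ℚ) • (hbar ^ 2 * d (d U)) - 3 * U ^ 2 = t) :
    C hbar • (LmatP1 (fun a => d a) hbar U).map (dcoef fun a => d a)
      - C hbar • (RmatP1 U).map derivative
      + (LmatP1 (fun a => d a) hbar U * RmatP1 U - RmatP1 U * LmatP1 (fun a => d a) hbar U)
    = 0 := by
  obtain ⟨t, ht, hU⟩ := hP1
  have two_half : 2 * algebraMap ℚ A[X] (1/2) = 1 := by
    rw [← map_ofNat (algebraMap ℚ A[X]) 2, ← map_mul]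
    norm_num
  have dtwo : dcoef (fun a => d a) (2 : A[X]) = 0 := by
    have h := dcoef_C d (2 : A)
    have h2 : d (2 : A) = 0 := by exact_mod_cast d.map_natCast 2
    rwa [h2, map_zero, map_ofNat] at h
  have dhbar : dcoef (fun a => d a) (C hbar ^ 2) = 0 := by
    rw [← C_pow, dcoef_C, d.leibniz_pow, hd]
    simp
  have hdU : (1/2 : ℚ) • (hbar ^ 2 * d (d (d U))) - 6 * (U * d U) = 1 := by
    have h3 : d (3 : A) = 0 := by exact_mod_cast d.map_natCast 3
    have h := congrArg d hU
    simp only [map_sub, d.map_smul, Derivation.leibniz, Derivation.leibniz_pow, hd, h3, ht,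
      smul_eq_mul, smul_zero, mul_zero, add_zero] at h
    rw [← h]
    simp only [nsmul_eq_mul]
    push_cast
    ring
  have hC : (1/2 : ℚ) • (C hbar ^ 2 * C (d (d (d U)))) - 6 * (C U * C (d U)) = 1 := by
    have h := congrArg (C : A → A[X]) hdU
    simpa [← smul_C, -one_div, map_ofNat C 6] using h
  rw [Algebra.smul_def] at hC
  ext1 i j
  fin_cases i <;> fin_cases j <;>
    simp [LmatP1, RmatP1, dcoef_add, dcoef_sub, dcoef_neg, dcoef_smul, dcoef_mul, dcoef_C,
      dcoef_X, dtwo, dhbar, hd, -one_div] <;>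
    simp only [Algebra.smul_def (1/2 : ℚ)]
  · ring
  · linear_combination (C hbar * C (d U)) * two_half
  · linear_combination C hbar * hC - C hbar * C (d U) * (X + 2 * C U) * two_half
  · ring
end
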